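/- arXiv:0808.0544 — 5 statements merged into one kernel-verified Lean document; each statement's English description precedes it below -/
import Mathlib

section
/- Let N ≥ 2 be an integer, let x be a positive divisor of N, and let s, s' be integers with 0 < s, s' < N, gcd(s, N) = 1 and gcd(s', N) = 1. Then the number of integers n with 0 ≤ n < N such that gcd(n, N) ≠ 1 and gcd(n − s, N) = x equals the number of integers n with 0 ≤ n < N such that gcd(n, N) ≠ 1 and gcd(n − s', N) = x (gcd denotes the nonnegative greatest common divisor of integers, with gcd(0, N) = N). -/
theorem Int.gcd_eq_of_modEq_mul_of_isCoprime {u a b m : ℤ} (hu : IsCoprime u m)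
    (h : a ≡ u * b [ZMOD m]) : Int.gcd a m = Int.gcd b m := by
  obtain ⟨k, hk⟩ := h.dvd
  obtain rfl : a = u * b + m * (-k) := by linarith
  rw [Int.gcd_add_mul_left_left]
  exact Int.gcd_mul_right_left_of_gcd_eq_one (Int.isCoprime_iff_gcd_eq_one.mp hu)

theorem card_noncoprime_gcd_shift_le {N : ℕ} (hN : 0 < N) (x : ℕ) {s s' : ℤ}
    (hs : IsCoprime s (N : ℤ)) (hs' : IsCoprime s' (N : ℤ)) :
    ((Finset.range N).filter
        (fun n => Nat.gcd n N ≠ 1 ∧ Int.gcd ((n : ℤ) - s) (N : ℤ) = x)).card ≤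
      ((Finset.range N).filter
        (fun n => Nat.gcd n N ≠ 1 ∧ Int.gcd ((n : ℤ) - s') (N : ℤ) = x)).card := by
  have hN' : (0 : ℤ) < N := by exact_mod_cast hN
  obtain ⟨t, r, htr⟩ := hs
  have ht : IsCoprime t (N : ℤ) := ⟨s, r, by linarith⟩
  have hu : IsCoprime (s' * t) (N : ℤ) := hs'.mul_left ht
  have hus : s' ≡ s' * t * s [ZMOD N] :=
    Int.modEq_iff_dvd.mpr ⟨-(s' * r), by linear_combination s' * htr⟩
  have hcast (n : ℕ) : (((s' * t * n) % N).toNat : ℤ) = (s' * t * n) % N :=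
    Int.toNat_of_nonneg (Int.emod_nonneg _ hN'.ne')
  have hmod (n : ℕ) : (((s' * t * n) % N).toNat : ℤ) ≡ s' * t * n [ZMOD N] := by
    rw [hcast]
    exact Int.mod_modEq _ _
  refine Finset.card_le_card_of_injOn (fun n : ℕ => ((s' * t * n) % N).toNat) ?_ ?_
  · intro n hn
    simp only [Finset.coe_filter, Finset.mem_range, Set.mem_ofPred_eq] at hn ⊢
    obtain ⟨-, hg, hx⟩ := hn
    refine ⟨?_, ?_, ?_⟩
    · zify
      rw [hcast]
      exact Int.emod_lt_of_pos _ hN'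
    · rwa [← Int.gcd_natCast_natCast, Int.gcd_eq_of_modEq_mul_of_isCoprime hu (hmod n),
        Int.gcd_natCast_natCast]
    · rw [← hx]
      refine Int.gcd_eq_of_modEq_mul_of_isCoprime hu ?_
      rw [mul_sub]
      exact (hmod n).sub hus
  · intro a ha b hb hab
    simp only [Finset.coe_filter, Finset.mem_range, Set.mem_ofPred_eq] at ha hb
    have h : s' * t * (a : ℤ) ≡ s' * t * b [ZMOD N] :=
      (hmod a).symm.trans ((congrArg (Nat.cast : ℕ → ℤ) hab) ▸ hmod b)
    have hdvd : (N : ℤ) ∣ b - a :=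
      hu.symm.dvd_of_dvd_mul_left (by rw [mul_sub]; exact h.dvd)
    exact Nat.ModEq.eq_of_lt_of_lt (Nat.modEq_iff_dvd.mpr hdvd) ha.1 hb.1

/-- For `N ≥ 2`, a positive divisor `x` of `N`, and `s, s'` coprime to `N`
with `0 < s, s' < N`, the number of `0 ≤ n < N` with `gcd(n, N) ≠ 1` and
`gcd(n - s, N) = x` equals the corresponding count for `s'`. -/
theorem card_noncoprime_gcd_shift_eq (N x : ℕ) (hN : 2 ≤ N) (hx : 0 < x) (hxN : x ∣ N)
    (s s' : ℤ) (hs0 : 0 < s) (hsN : s < (N : ℤ)) (hs'0 : 0 < s') (hs'N : s' < (N : ℤ))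
    (hgs : Int.gcd s (N : ℤ) = 1) (hgs' : Int.gcd s' (N : ℤ) = 1) :
    ((Finset.range N).filter
        (fun n => Nat.gcd n N ≠ 1 ∧ Int.gcd ((n : ℤ) - s) (N : ℤ) = x)).card =
      ((Finset.range N).filter
        (fun n => Nat.gcd n N ≠ 1 ∧ Int.gcd ((n : ℤ) - s') (N : ℤ) = x)).card := by
  have hs := Int.isCoprime_iff_gcd_eq_one.mpr hgs
  have hs' := Int.isCoprime_iff_gcd_eq_one.mpr hgs'
  have hN0 : 0 < N := by omega
  exact (card_noncoprime_gcd_shift_le hN0 x hs hs').antisymm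
    (card_noncoprime_gcd_shift_le hN0 x hs' hs)
end

section
/- Let N ≥ 2 be an integer, let x be a positive integer, and let s, s' ∈ μ_N = {n : 0 < n < N, gcd(n, N) = 1}. Then the number of r ∈ μ_N with gcd(r − s, N) = x equals the number of r ∈ μ_N with gcd(r − s', N) = x (gcd denotes the nonnegative greatest common divisor of integers, with gcd(0, N) = N). In other words, |G_{N,x}(R_{N,s})| = |G_{N,x}(R_{N,s'})|. -/
/-- Multiplication by `u` modulo `N` embeds the `r` coprime to `N` with `gcd (r - s, N) = x` into
those with `gcd (r - s', N) = x`, whenever `u` is coprime to `N` and `u * s ≡ s' [MOD N]`. -/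
lemma card_filter_gcd_sub_le_of_mul_modEq {N x u s s' : ℕ} (hN : 2 ≤ N)
    (hu : u.Coprime N) (hus : u * s ≡ s' [MOD N]) :
    ((Finset.range N).filter
        (fun r => 0 < r ∧ Nat.gcd r N = 1 ∧ Int.gcd ((r : ℤ) - (s : ℤ)) (N : ℤ) = x)).card ≤
      ((Finset.range N).filter
        (fun r => 0 < r ∧ Nat.gcd r N = 1 ∧
          Int.gcd ((r : ℤ) - (s' : ℤ)) (N : ℤ) = x)).card := by
  refine Finset.card_le_card_of_injOn (fun r => u * r % N) ?_ ?_
  · intro r hr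
    simp only [Finset.coe_filter, Finset.mem_range, Set.mem_ofPred_eq] at hr ⊢
    obtain ⟨-, -, hrN, hrx⟩ := hr
    have hcop : Nat.gcd (u * r % N) N = 1 := by
      rw [(Nat.mod_modEq (u * r) N).gcd_eq]
      exact Nat.Coprime.mul_left hu hrN
    refine ⟨Nat.mod_lt _ (by lia), Nat.pos_of_ne_zero fun h => ?_, hcop, ?_⟩
    · rw [h, Nat.gcd_zero_left] at hcop
      lia
    · have hmod : ((u * r % N : ℕ) : ℤ) - s' ≡ u * ((r : ℤ) - s) [ZMOD N] := by
        rw [mul_sub]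
        exact Int.ModEq.sub (by exact_mod_cast Nat.mod_modEq (u * r) N)
          (by exact_mod_cast hus.symm)
      rw [← Int.gcd_emod, hmod, Int.gcd_emod, Int.gcd_mul_right_left_of_gcd_eq_one, hrx]
      exact hu
  · intro a ha b hb hab
    simp only [Finset.coe_filter, Finset.mem_range, Set.mem_ofPred_eq] at ha hb
    exact (Nat.ModEq.cancel_left_of_coprime (Nat.coprime_comm.mp hu) hab).eq_of_lt_of_lt ha.1 hb.1

/-- A residue coprime to `N` is carried to any other by multiplication by a unit modulo `N`. -/
lemma exists_coprime_mul_modEq {N s s' : ℕ} (hN : 2 ≤ N) (hs : s.Coprime N)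
    (hs' : s'.Coprime N) : ∃ u : ℕ, u.Coprime N ∧ u * s ≡ s' [MOD N] := by
  obtain ⟨m, -, hm⟩ := Nat.exists_mul_mod_eq_one_of_coprime hs hN
  have hsm : s * m ≡ 1 [MOD N] := by
    rw [Nat.ModEq, hm, Nat.mod_eq_of_lt hN]
  have hmN : m.Coprime N :=
    Nat.Coprime.coprime_mul_left (k := s) (by simpa [Nat.Coprime] using hsm.gcd_eq)
  refine ⟨m * s', hmN.mul_left hs', ?_⟩
  calc m * s' * s = s * m * s' := by ring
    _ ≡ 1 * s' [MOD N] := hsm.mul_right s'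
    _ = s' := one_mul s'

/-- For `N ≥ 2`, `x ≥ 1` and `s, s' ∈ μ_N = {n : 0 < n < N, gcd(n, N) = 1}`,
the number of `r ∈ μ_N` with `gcd(r - s, N) = x` equals the number of
`r ∈ μ_N` with `gcd(r - s', N) = x`. -/
theorem card_G_eq_of_mem_mu (N x : ℕ) (hN : 2 ≤ N) (hx : 0 < x)
    (s s' : ℕ) (hs0 : 0 < s) (hsN : s < N) (hgs : Nat.gcd s N = 1)
    (hs'0 : 0 < s') (hs'N : s' < N) (hgs' : Nat.gcd s' N = 1) :
    ((Finset.range N).filter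
        (fun r => 0 < r ∧ Nat.gcd r N = 1 ∧ Int.gcd ((r : ℤ) - (s : ℤ)) (N : ℤ) = x)).card =
      ((Finset.range N).filter
        (fun r => 0 < r ∧ Nat.gcd r N = 1 ∧ Int.gcd ((r : ℤ) - (s' : ℤ)) (N : ℤ) = x)).card := by
  obtain ⟨u, hu, hus⟩ := exists_coprime_mul_modEq hN hgs hgs'
  obtain ⟨v, hv, hvs⟩ := exists_coprime_mul_modEq hN hgs' hgs
  exact le_antisymm (card_filter_gcd_sub_le_of_mul_modEq hN hu hus)
    (card_filter_gcd_sub_le_of_mul_modEq hN hv hvs)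
end

section
/- Let N = p^c be a prime power with p prime and c ≥ 1, let s ∈ μ_N = {n : 0 < n < N, gcd(n, N) = 1}, and let x = p^n with 0 ≤ n ≤ c. Then the number of r ∈ μ_N with gcd(r − s, N) = x (with gcd(0, N) = N) equals: 1 if n = c; p^{c−n} − p^{c−n−1} if 0 < n < c; and p^c − 2·p^{c−1} if n = 0. -/
theorem Nat.Prime.gcd_pow_eq_pow_iff {p : ℕ} (hp : p.Prime) {n c : ℕ} (hnc : n < c) (a : ℕ) :
    Nat.gcd a (p ^ c) = p ^ n ↔ p ^ n ∣ a ∧ ¬ p ^ (n + 1) ∣ a := by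
  obtain ⟨k, hk, hgk⟩ := (Nat.dvd_prime_pow hp).1 (Nat.gcd_dvd_right a (p ^ c))
  have key (m : ℕ) (hm : m ≤ c) : p ^ m ∣ a ↔ m ≤ k := by
    rw [← Nat.pow_dvd_pow_iff_le_right hp.one_lt, ← hgk, Nat.dvd_gcd_iff]
    exact ⟨fun h => ⟨h, pow_dvd_pow p hm⟩, fun h => h.1⟩
  rw [key n hnc.le, key (n + 1) hnc, hgk, Nat.pow_right_inj hp.one_lt]
  omega

theorem Nat.natAbs_sub_dvd_iff_modEq (d r s : ℕ) :
    d ∣ ((r : ℤ) - (s : ℤ)).natAbs ↔ r ≡ s [MOD d] := by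
  rw [← Int.natCast_dvd, ← Nat.modEq_iff_dvd]
  exact ⟨Nat.ModEq.symm, Nat.ModEq.symm⟩

theorem Nat.card_filter_range_pow_modEq {p : ℕ} (hp : 0 < p) {m c : ℕ} (hm : m ≤ c) (s : ℕ) :
    ((Finset.range (p ^ c)).filter (fun r => r ≡ s [MOD p ^ m])).card = p ^ (c - m) := by
  rw [← Nat.count_eq_card_filter_range, Nat.count_modEq_card _ (pow_pos hp m),
    Nat.mod_eq_zero_of_dvd (pow_dvd_pow p hm), Nat.pow_div hm hp]
  simp

/-- For a prime power `N = p^c` (`c ≥ 1`), `s ∈ μ_N` and `x = p^n` with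
`0 ≤ n ≤ c`, the number of `r ∈ μ_N` with `gcd(r - s, N) = p^n` is `1` if
`n = c`, `p^(c-n) - p^(c-n-1)` if `0 < n < c`, and `p^c - 2·p^(c-1)` if `n = 0`. -/
theorem card_G_prime_pow (p : ℕ) (hp : p.Prime) (c : ℕ) (hc : 1 ≤ c)
    (s : ℕ) (hs0 : 0 < s) (hsN : s < p ^ c) (hgs : Nat.gcd s (p ^ c) = 1)
    (n : ℕ) (hn : n ≤ c) :
    ((Finset.range (p ^ c)).filter
        (fun r => 0 < r ∧ Nat.gcd r (p ^ c) = 1 ∧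
          Int.gcd ((r : ℤ) - (s : ℤ)) ((p : ℤ) ^ c) = p ^ n)).card =
      if n = c then 1
      else if 0 < n then p ^ (c - n) - p ^ (c - n - 1)
      else p ^ c - 2 * p ^ (c - 1) := by
  have hcop (r : ℕ) : Nat.gcd r (p ^ c) = 1 ↔ ¬ p ∣ r := by
    simpa using hp.gcd_pow_eq_pow_iff hc r
  have hps : ¬ p ∣ s := (hcop s).1 hgs
  have hgcd (r : ℕ) : Int.gcd ((r : ℤ) - (s : ℤ)) ((p : ℤ) ^ c)
      = Nat.gcd ((r : ℤ) - (s : ℤ)).natAbs (p ^ c) := by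
    rw [Int.gcd_def, Int.natAbs_pow, Int.natAbs_natCast]
  have hpos (r : ℕ) (hr : ¬ p ∣ r) : 0 < r :=
    Nat.pos_of_ne_zero fun h => hr (h ▸ dvd_zero p)
  simp only [hgcd, hcop]
  rcases hn.eq_or_lt with rfl | hnc
  · rw [if_pos rfl, Finset.card_eq_one]
    refine ⟨s, ?_⟩
    ext r
    simp only [Finset.mem_filter, Finset.mem_range, Finset.mem_singleton, Nat.gcd_eq_right_iff_dvd,
      Nat.natAbs_sub_dvd_iff_modEq]
    constructor
    · rintro ⟨hr, -, -, h⟩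
      exact h.eq_of_lt_of_lt hr hsN
    · rintro rfl
      exact ⟨hsN, hs0, hps, Nat.ModEq.refl _⟩
  simp only [hp.gcd_pow_eq_pow_iff hnc, Nat.natAbs_sub_dvd_iff_modEq]
  rw [if_neg hnc.ne]
  split_ifs with hn0
  · rw [Nat.sub_sub, ← Nat.card_filter_range_pow_modEq hp.pos hnc.le s,
      ← Nat.card_filter_range_pow_modEq hp.pos (Nat.succ_le_of_lt hnc) s,
      ← Finset.card_sdiff_of_subset]
    · congr 1
      ext r
      simp only [Finset.mem_filter, Finset.mem_range, Finset.mem_sdiff]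
      constructor
      · tauto
      · rintro ⟨⟨hr, h⟩, h'⟩
        have hpr : ¬ p ∣ r := by
          rwa [h.dvd_iff (dvd_pow_self p hn0.ne')]
        exact ⟨hr, hpos r hpr, hpr, h, fun h2 => h' ⟨hr, h2⟩⟩
    · intro r
      simp only [Finset.mem_filter]
      exact fun h => ⟨h.1, h.2.of_dvd (pow_dvd_pow p n.le_succ)⟩
  · obtain rfl : n = 0 := by omega
    have hdisj : Disjoint ((Finset.range (p ^ c)).filter (fun r => r ≡ 0 [MOD p ^ 1]))
        ((Finset.range (p ^ c)).filter (fun r => r ≡ s [MOD p ^ 1])) := by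
      rw [Finset.disjoint_filter]
      intro r _ h0 h1
      rw [pow_one] at h0 h1
      exact hps ((h1.dvd_iff dvd_rfl).1 (Nat.modEq_zero_iff_dvd.1 h0))
    have hcard := Finset.card_union_of_disjoint hdisj
    rw [Nat.card_filter_range_pow_modEq hp.pos hc, Nat.card_filter_range_pow_modEq hp.pos hc,
      ← two_mul] at hcard
    rw [← hcard]
    nth_rw 2 [← Finset.card_range (p ^ c)]
    rw [← Finset.card_sdiff_of_subset
      (Finset.union_subset (Finset.filter_subset _ _) (Finset.filter_subset _ _))]
    congr 1
    ext r
    simp only [Finset.mem_filter, Finset.mem_range, Finset.mem_sdiff, Finset.mem_union, pow_zero,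
      zero_add, pow_one, Nat.modEq_zero_iff_dvd, Nat.modEq_one, true_and]
    have := hpos r
    tauto
end

section
/- Let N ≥ 2 be an integer, let x be a positive divisor of N, and let s ∈ μ_N = {n : 0 < n < N, gcd(n, N) = 1}. For each prime p dividing N, write c_p for the multiplicity of p in N and n_p for the multiplicity of p in x. Then the number of r ∈ μ_N with gcd(r − s, N) = x (with gcd(0, N) = N) equals the product over all primes p dividing N of t_p, where t_p = p^{c_p} − 2·p^{c_p−1} if p does not divide x; t_p = p^{c_p−n_p} − p^{c_p−n_p−1} if p divides x and n_p < c_p; and t_p = 1 if n_p = c_p. -/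
/-- The residues `r < N` prime to `N` such that `r - s` and `x` have the same greatest common
divisor with `N`. -/
def coprimeResiduesWithGcd (x s N : ℕ) : Finset ℕ :=
  (Finset.range N).filter
    (fun r => Nat.gcd r N = 1 ∧ Int.gcd ((r : ℤ) - (s : ℤ)) (N : ℤ) = Nat.gcd x N)

theorem card_range_filter_modEq_of_dvd {m M : ℕ} (hm : 0 < m) (h : m ∣ M) (v : ℕ) :
    ((Finset.range M).filter (fun r => r ≡ v [MOD m])).card = M / m := by
  rw [← Nat.count_eq_card_filter_range, Nat.count_modEq_card _ hm, Nat.mod_eq_zero_of_dvd h]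
  simp

theorem natCast_dvd_sub_iff_modEq (m r s : ℕ) : (m : ℤ) ∣ (r : ℤ) - s ↔ r ≡ s [MOD m] := by
  rw [← Nat.modEq_iff_dvd]
  exact ⟨Nat.ModEq.symm, Nat.ModEq.symm⟩

theorem gcd_mul_eq_gcd_mul_iff {a b : ℕ} (hab : a.Coprime b) (y x : ℕ) :
    y.gcd (a * b) = x.gcd (a * b) ↔ y.gcd a = x.gcd a ∧ y.gcd b = x.gcd b := by
  constructor
  · intro h
    constructor
    · simpa [Nat.gcd_assoc] using congrArg (Nat.gcd · a) h
    · simpa [Nat.gcd_assoc] using congrArg (Nat.gcd · b) h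
  · rintro ⟨h₁, h₂⟩
    rw [hab.gcd_mul, hab.gcd_mul, h₁, h₂]

theorem int_gcd_sub_congr {a r r' : ℕ} (h : r ≡ r' [MOD a]) (s : ℕ) :
    Int.gcd ((r : ℤ) - s) a = Int.gcd ((r' : ℤ) - s) a := by
  have h' : (r : ℤ) - s ≡ (r' : ℤ) - s [ZMOD a] :=
    ((Int.natCast_modEq_iff).2 h).sub_right _
  rw [← Int.gcd_emod, h'.eq, Int.gcd_emod]

theorem card_coprimeResiduesWithGcd_mul {a b : ℕ} (ha : 0 < a) (hb : 0 < b)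
    (hab : a.Coprime b) (x s : ℕ) :
    (coprimeResiduesWithGcd x s (a * b)).card =
      (coprimeResiduesWithGcd x s a).card * (coprimeResiduesWithGcd x s b).card := by
  have split (r : ℕ) : (Nat.gcd r (a * b) = 1 ∧
      Int.gcd ((r : ℤ) - s) ((a * b : ℕ) : ℤ) = Nat.gcd x (a * b)) ↔
      (Nat.gcd r a = 1 ∧ Int.gcd ((r : ℤ) - s) a = Nat.gcd x a) ∧
      (Nat.gcd r b = 1 ∧ Int.gcd ((r : ℤ) - s) b = Nat.gcd x b) := by
    have h₁ : Nat.gcd r (a * b) = 1 ↔ Nat.gcd r a = 1 ∧ Nat.gcd r b = 1 :=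
      Nat.coprime_mul_iff_right
    have h₂ := gcd_mul_eq_gcd_mul_iff hab ((r : ℤ) - s).natAbs x
    simp only [Int.gcd, Int.natAbs_natCast]
    rw [h₁, h₂]
    tauto
  have transfer {m r r' : ℕ} (h : r ≡ r' [MOD m]) :
      (Nat.gcd r m = 1 ∧ Int.gcd ((r : ℤ) - s) m = Nat.gcd x m) ↔
      (Nat.gcd r' m = 1 ∧ Int.gcd ((r' : ℤ) - s) m = Nat.gcd x m) := by
    rw [int_gcd_sub_congr h s, h.gcd_eq]
  rw [← Finset.card_product]
  refine Finset.card_bij (fun r _ => (r % a, r % b)) ?_ ?_ ?_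
  · intro r hr
    simp only [coprimeResiduesWithGcd, Finset.mem_product, Finset.mem_filter,
      Finset.mem_range] at hr ⊢
    obtain ⟨-, hr⟩ := hr
    rw [split] at hr
    exact ⟨⟨Nat.mod_lt _ ha, (transfer (Nat.mod_modEq r a)).2 hr.1⟩,
      Nat.mod_lt _ hb, (transfer (Nat.mod_modEq r b)).2 hr.2⟩
  · intro r hr r' hr' h
    simp only [coprimeResiduesWithGcd, Finset.mem_filter, Finset.mem_range] at hr hr'
    rw [Prod.mk.injEq] at h
    exact Nat.ModEq.eq_of_lt_of_lt ((Nat.modEq_and_modEq_iff_modEq_mul hab).1 h) hr.1 hr'.1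
  · rintro ⟨u, v⟩ huv
    simp only [coprimeResiduesWithGcd, Finset.mem_product, Finset.mem_filter,
      Finset.mem_range] at huv
    obtain ⟨⟨hu, hu'⟩, hv, hv'⟩ := huv
    have hc := (Nat.chineseRemainder hab u v).2
    refine ⟨Nat.chineseRemainder hab u v, ?_, ?_⟩
    · simp only [coprimeResiduesWithGcd, Finset.mem_filter, Finset.mem_range]
      refine ⟨Nat.chineseRemainder_lt_mul hab u v ha.ne' hb.ne', ?_⟩
      rw [split]
      exact ⟨(transfer hc.1).2 hu', (transfer hc.2).2 hv'⟩
    · exact Prod.ext (Nat.mod_eq_of_modEq hc.1 hu) (Nat.mod_eq_of_modEq hc.2 hv)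

theorem gcd_prime_pow_eq_pow_iff {p n c : ℕ} (hp : p.Prime) (hn : n < c) (y : ℕ) :
    y.gcd (p ^ c) = p ^ n ↔ p ^ n ∣ y ∧ ¬ p ^ (n + 1) ∣ y := by
  constructor
  · intro h
    refine ⟨h ▸ Nat.gcd_dvd_left _ _, fun h' => ?_⟩
    have := Nat.dvd_gcd h' (pow_dvd_pow p (show n + 1 ≤ c from hn))
    rw [h, Nat.pow_dvd_pow_iff_le_right hp.one_lt] at this
    omega
  · rintro ⟨h₁, h₂⟩
    obtain ⟨k, hk, h⟩ := (Nat.dvd_prime_pow hp).1 (Nat.gcd_dvd_right y (p ^ c))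
    have hnk := Nat.dvd_gcd h₁ (pow_dvd_pow p hn.le)
    rw [h, Nat.pow_dvd_pow_iff_le_right hp.one_lt] at hnk
    have hkn : ¬ n + 1 ≤ k := fun hle =>
      h₂ ((pow_dvd_pow p hle).trans (h ▸ Nat.gcd_dvd_left _ _))
    rw [h, show k = n by omega]

theorem int_gcd_sub_prime_pow_eq_pow_iff {p n c : ℕ} (hp : p.Prime) (hn : n < c) (r s : ℕ) :
    Int.gcd ((r : ℤ) - s) ((p ^ c : ℕ) : ℤ) = p ^ n ↔
      r ≡ s [MOD p ^ n] ∧ ¬ r ≡ s [MOD p ^ (n + 1)] := by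
  rw [Int.gcd, Int.natAbs_natCast, gcd_prime_pow_eq_pow_iff hp hn, ← Int.natCast_dvd,
    ← Int.natCast_dvd, natCast_dvd_sub_iff_modEq, natCast_dvd_sub_iff_modEq]

theorem card_coprimeResiduesWithGcd_prime_pow {p c x s : ℕ} (hp : p.Prime) (hc : 0 < c)
    (hx : 0 < x) (hs : s.Coprime p) :
    (coprimeResiduesWithGcd x s (p ^ c)).card =
      if ¬ p ∣ x then p ^ c - 2 * p ^ (c - 1)
      else if x.factorization p < c then
        p ^ (c - x.factorization p) - p ^ (c - x.factorization p - 1)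
      else 1 := by
  have card_modEq {k : ℕ} (hk : k ≤ c) (v : ℕ) :
      ((Finset.range (p ^ c)).filter (fun r => r ≡ v [MOD p ^ k])).card = p ^ (c - k) := by
    rw [card_range_filter_modEq_of_dvd (pow_pos hp.pos k) (pow_dvd_pow p hk),
      Nat.pow_div hk hp.pos]
  have coprime_iff (r : ℕ) : Nat.gcd r (p ^ c) = 1 ↔ ¬ r ≡ 0 [MOD p] := by
    rw [Nat.modEq_zero_iff_dvd, ← hp.coprime_iff_not_dvd, Nat.coprime_comm]
    exact Nat.coprime_pow_right_iff hc r p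
  have hs0 : ¬ s ≡ 0 [MOD p] := by
    rwa [Nat.modEq_zero_iff_dvd, ← hp.coprime_iff_not_dvd, Nat.coprime_comm]
  have gcd_x (h : x.factorization p < c) : x.gcd (p ^ c) = p ^ x.factorization p :=
    (gcd_prime_pow_eq_pow_iff hp h x).2
      ⟨Nat.ordProj_dvd x p, Nat.pow_succ_factorization_not_dvd hx.ne' hp⟩
  unfold coprimeResiduesWithGcd
  by_cases hpx : p ∣ x
  · have hpos : 1 ≤ x.factorization p := (hp.dvd_iff_one_le_factorization hx.ne').1 hpx
    have coprime_of_modEq {k r : ℕ} (hk : 1 ≤ k) (h : r ≡ s [MOD p ^ k]) :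
        ¬ r ≡ 0 [MOD p] := fun h0 =>
      hs0 ((h.of_dvd (dvd_pow_self p (by omega))).symm.trans h0)
    rw [if_neg (not_not.2 hpx)]
    split_ifs with hlt
    · rw [gcd_x hlt]
      simp only [coprime_iff, int_gcd_sub_prime_pow_eq_pow_iff hp hlt]
      rw [← card_modEq hlt.le s, Nat.sub_sub, ← card_modEq hlt s,
        ← Finset.card_sdiff_of_subset]
      · congr 1
        ext r
        simp only [Finset.mem_filter, Finset.mem_sdiff]
        have := @coprime_of_modEq _ r hpos
        tauto
      · intro r
        simp only [Finset.mem_filter]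
        exact fun h => ⟨h.1, h.2.of_dvd (pow_dvd_pow p (Nat.le_succ _))⟩
    · have hle : p ^ c ∣ x := (hp.pow_dvd_iff_le_factorization hx.ne').2 (not_lt.1 hlt)
      have key (r : ℕ) : Int.gcd ((r : ℤ) - s) ((p ^ c : ℕ) : ℤ) = x.gcd (p ^ c) ↔
          r ≡ s [MOD p ^ c] := by
        rw [Nat.gcd_eq_right hle, ← natCast_dvd_sub_iff_modEq, Int.natCast_dvd, Int.gcd,
          Int.natAbs_natCast, Nat.gcd_eq_right_iff_dvd]
      simp only [coprime_iff, key]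
      have card_one := card_modEq le_rfl s
      rw [Nat.sub_self, pow_zero] at card_one
      rw [← card_one]
      congr 1
      ext r
      simp only [Finset.mem_filter]
      have := @coprime_of_modEq c r hc
      tauto
  · have h0 : x.factorization p = 0 := Nat.factorization_eq_zero_of_not_dvd hpx
    have hlt : x.factorization p < c := h0 ▸ hc
    rw [if_pos hpx, gcd_x hlt]
    simp only [coprime_iff, int_gcd_sub_prime_pow_eq_pow_iff hp hlt]
    rw [h0]
    have card_one (v : ℕ) := pow_one p ▸ card_modEq (k := 1) hc v
    have hdisj : Disjoint ((Finset.range (p ^ c)).filter (fun r => r ≡ 0 [MOD p]))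
        ((Finset.range (p ^ c)).filter (fun r => r ≡ s [MOD p])) :=
      Finset.disjoint_filter.2 fun r _ h h' => hs0 (h'.symm.trans h)
    have hunion := Finset.card_union_of_disjoint hdisj
    rw [card_one, card_one, ← two_mul] at hunion
    rw [← hunion]
    nth_rewrite 2 [← Finset.card_range (p ^ c)]
    rw [← Finset.card_sdiff_of_subset]
    · congr 1
      ext r
      simp only [Finset.mem_filter, Finset.mem_sdiff, Finset.mem_union, pow_zero, zero_add,
        pow_one, Nat.modEq_one, true_and]
      tauto
    · exact Finset.union_subset (Finset.filter_subset _ _) (Finset.filter_subset _ _)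

theorem card_coprimeResiduesWithGcd {x s : ℕ} (hx : 0 < x) (N : ℕ) (hN : 0 < N)
    (hs : s.Coprime N) :
    (coprimeResiduesWithGcd x s N).card =
      ∏ p ∈ N.primeFactors,
        (if ¬ p ∣ x then p ^ (N.factorization p) - 2 * p ^ (N.factorization p - 1)
         else if x.factorization p < N.factorization p then
           p ^ (N.factorization p - x.factorization p) -
             p ^ (N.factorization p - x.factorization p - 1)
         else 1) := by
  induction N using Nat.recOnPosPrimePosCoprime with
  | zero => omega
  | one => simp [coprimeResiduesWithGcd]
  | prime_pow p c hp hc =>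
    rw [card_coprimeResiduesWithGcd_prime_pow hp hc hx ((Nat.coprime_pow_right_iff hc _ _).1 hs),
      Nat.primeFactors_prime_pow hc.ne' hp, Finset.prod_singleton, hp.factorization_pow,
      Finsupp.single_eq_same]
  | coprime a b ha hb hab iha ihb =>
    rw [card_coprimeResiduesWithGcd_mul (by omega) (by omega) hab,
      iha (by omega) (hs.coprime_mul_right_right), ihb (by omega) (hs.coprime_mul_left_right),
      hab.primeFactors_mul, Finset.prod_union hab.disjoint_primeFactors]
    congr 1
    · refine Finset.prod_congr rfl fun p hp => ?_
      rw [Nat.factorization_eq_of_coprime_left hab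
        (Nat.mem_primeFactors_iff_mem_primeFactorsList.1 hp)]
    · refine Finset.prod_congr rfl fun p hp => ?_
      rw [Nat.factorization_eq_of_coprime_right hab
        (Nat.mem_primeFactors_iff_mem_primeFactorsList.1 hp)]

/-- For `N ≥ 2`, a positive divisor `x` of `N` and `s ∈ μ_N`, the number of
`r ∈ μ_N` with `gcd(r - s, N) = x` equals `∏_p t_p` over the primes `p ∣ N`,
where, writing `c_p` and `n_p` for the multiplicities of `p` in `N` and `x`,
`t_p = p^{c_p} - 2 p^{c_p-1}` if `p ∤ x`, `t_p = p^{c_p-n_p} - p^{c_p-n_p-1}`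
if `p ∣ x` and `n_p < c_p`, and `t_p = 1` if `n_p = c_p`. -/
theorem card_G_general (N : ℕ) (hN : 2 ≤ N) (x : ℕ) (hx : 0 < x) (hxN : x ∣ N)
    (s : ℕ) (hs0 : 0 < s) (hsN : s < N) (hgs : Nat.gcd s N = 1) :
    ((Finset.range N).filter
        (fun r => 0 < r ∧ Nat.gcd r N = 1 ∧ Int.gcd ((r : ℤ) - (s : ℤ)) (N : ℤ) = x)).card =
      ∏ p ∈ N.primeFactors,
        (if ¬ p ∣ x then p ^ (N.factorization p) - 2 * p ^ (N.factorization p - 1)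
         else if x.factorization p < N.factorization p then
           p ^ (N.factorization p - x.factorization p) -
             p ^ (N.factorization p - x.factorization p - 1)
         else 1) := by
  rw [← card_coprimeResiduesWithGcd hx N (by omega) hgs, coprimeResiduesWithGcd,
    Nat.gcd_eq_left hxN]
  congr 1
  refine Finset.filter_congr fun r _ => ⟨And.right, fun h => ⟨?_, h⟩⟩
  refine Nat.pos_of_ne_zero fun h0 => ?_
  have h1 := h.1
  rw [h0, Nat.gcd_zero_left] at h1
  omega
end

section
/- Let N ≥ 2 be an integer, let θ be a real number with N ≤ θ² < N², and let x be any positive divisor of N with N·x > θ². If A ⊆ μ_N = {n : 0 < n < N, gcd(n, N) = 1} is such that every pair of distinct r, s ∈ A satisfies N · gcd(r − s, N) ≤ θ² (equivalently, the partial Chu sequence set C_A satisfies θ̂_c^A ≤ θ), then |A| ≤ φ(x), where φ is Euler's totient function. Consequently |A| ≤ min{φ(x) : x a positive divisor of N with N·x > θ²}. -/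
open Complex Finset

/-- The Chu sequence of length `N` and root index `r`, as an `N`-periodic
complex sequence: `a_r(k) = exp(iπ r k²/N)` for even `N` and
`a_r(k) = exp(iπ r k(k+1)/N)` for odd `N`. -/
noncomputable def chu (N : ℕ) (r : ℤ) (k : ℤ) : ℂ :=
  if Even N then Complex.exp ((Real.pi : ℂ) * Complex.I * (r : ℂ) * (k : ℂ) ^ 2 / (N : ℂ))
  else Complex.exp ((Real.pi : ℂ) * Complex.I * (r : ℂ) * ((k : ℂ) * ((k : ℂ) + 1)) / (N : ℂ))

/-- The periodic cross-correlation of the Chu sequences `a_r` and `a_s`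
of length `N` at lag `τ`: `θ_{r,s}(τ) = Σ_{k=0}^{N-1} a_r(k) conj(a_s(k+τ))`. -/
noncomputable def crossCorr (N : ℕ) (r s : ℤ) (τ : ℤ) : ℂ :=
  ∑ k ∈ Finset.range N, chu N r k * (starRingEnd ℂ) (chu N s ((k : ℤ) + τ))

/-- Upper bound of Theorem 5: for `N ≥ 2`, `N ≤ θ² < N²` and any positive
divisor `x` of `N` with `N·x > θ²`, every subset `A ⊆ μ_N` all of whose
distinct pairs satisfy `N·gcd(r-s, N) ≤ θ²` (i.e. `θ̂_c^A ≤ θ`) has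
cardinality at most `φ(x)`; hence `|A|` is at most the minimum of `φ(x)`
over such divisors `x`. -/
theorem chu_partial_set_card_upper_bound (N : ℕ) (hN : 2 ≤ N)
    (θ : ℝ) (hθ1 : (N : ℝ) ≤ θ ^ 2) (hθ2 : θ ^ 2 < (N : ℝ) ^ 2)
    (x : ℕ) (hx0 : 0 < x) (hxN : x ∣ N) (hxθ : θ ^ 2 < (N : ℝ) * (x : ℝ))
    (A : Finset ℕ) (hA : ∀ n ∈ A, 0 < n ∧ n < N ∧ Nat.gcd n N = 1)
    (hbound : ∀ r ∈ A, ∀ s ∈ A, r ≠ s →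
      (N : ℝ) * (Int.gcd ((r : ℤ) - (s : ℤ)) (N : ℤ) : ℝ) ≤ θ ^ 2) :
    A.card ≤ Nat.totient x := by
  have h_inj : Set.InjOn (fun r : ℕ => r % x) (A : Set ℕ) := by
    intro r hr s hs hrs
    by_contra hne
    have h_dvd : (x : ℤ) ∣ (r : ℤ) - (s : ℤ) :=
      (Nat.modEq_iff_dvd.mp (show s ≡ r [MOD x] from hrs.symm))
    have h_gcd : x ∣ Int.gcd ((r : ℤ) - (s : ℤ)) (N : ℤ) :=
      Int.dvd_gcd h_dvd (Int.natCast_dvd_natCast.mpr hxN)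
    have h_pos : 0 < Int.gcd ((r : ℤ) - (s : ℤ)) (N : ℤ) :=
      Int.gcd_pos_of_ne_zero_left _ (sub_ne_zero.mpr (Nat.cast_injective.ne hne))
    have h_le : (x : ℝ) ≤ (Int.gcd ((r : ℤ) - (s : ℤ)) (N : ℤ) : ℝ) :=
      Nat.cast_le.mpr (Nat.le_of_dvd h_pos h_gcd)
    have h_mul := mul_le_mul_of_nonneg_left h_le (Nat.cast_nonneg (α := ℝ) N)
    linarith [hbound r hr s hs hne]
  rw [Nat.totient_eq_card_coprime]
  refine Finset.card_le_card_of_injOn (fun r => r % x) (fun r hr => ?_) h_inj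
  have h_cop : Nat.Coprime r x := Nat.Coprime.coprime_dvd_right hxN (hA r hr).2.2
  simp only [Finset.coe_filter, Set.mem_ofPred_eq, Finset.mem_range]
  refine ⟨Nat.mod_lt _ hx0, ?_⟩
  rwa [Nat.Coprime, Nat.gcd_comm, ← Nat.gcd_rec, Nat.gcd_comm]
end
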